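/- For every integer D ≥ 1 there exists a nonzero polynomial G in the variables (c_{ij})_{i+j≤D} and (u₁,u₂) such that whenever G(c,u) ≠ 0, the polynomial f_c := Σ_{i+j≤D} c_{ij} z₁^i z₂^j has exactly D² ML-critical points for u in (ℂ*)². (The ML degree of a general very affine plane curve of degree D equals D², i.e., r₀ = D².) -/

import Mathlib

open MvPolynomial

/-- Index set for the coefficients `c_{ij}` with `i + j ≤ D` of a plane curve of degree `D`. -/
abbrev CoeffIdx (D : ℕ) := {p : Fin (D + 1) × Fin (D + 1) // (p.1 : ℕ) + (p.2 : ℕ) ≤ D}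

/-- The plane curve `f_c = Σ_{i+j≤D} c_{ij} z₁^i z₂^j` with coefficients `c`. -/
noncomputable def planeCurve (D : ℕ) (c : CoeffIdx D → ℂ) : MvPolynomial (Fin 2) ℂ :=
  ∑ p : CoeffIdx D, C (c p) * X 0 ^ (p.1.1 : ℕ) * X 1 ^ (p.1.2 : ℕ)

namespace MLDegree

open Polynomial (resultant evalRingHom mapRingHom)
open scoped Polynomial

section TotalDegree

variable {K : Type*} [CommRing K]

/-- The total degree of a polynomial in two variables `t` (inner) and `w` (outer) is at most `n`. -/
def TotalDegreeLE (n : ℕ) (p : K[X][X]) : Prop :=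
  ∀ k l, n < k + l → (p.coeff k).coeff l = 0

lemma TotalDegreeLE.mono {m n : ℕ} {p : K[X][X]} (hp : TotalDegreeLE m p) (hmn : m ≤ n) :
    TotalDegreeLE n p :=
  fun k l h ↦ hp k l (hmn.trans_lt h)

lemma TotalDegreeLE.mul {m n : ℕ} {p q : K[X][X]} (hp : TotalDegreeLE m p)
    (hq : TotalDegreeLE n q) : TotalDegreeLE (m + n) (p * q) := by
  intro k l h
  rw [Polynomial.coeff_mul, Polynomial.finsetSum_coeff]
  refine Finset.sum_eq_zero fun x hx ↦ ?_
  rw [Polynomial.coeff_mul]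
  refine Finset.sum_eq_zero fun y hy ↦ ?_
  rw [Finset.HasAntidiagonal.mem_antidiagonal] at hx hy
  by_cases h₁ : m < x.1 + y.1
  · rw [hp _ _ h₁, zero_mul]
  · rw [hq x.2 y.2 (by omega), mul_zero]

lemma TotalDegreeLE.pow {m : ℕ} {p : K[X][X]} (hp : TotalDegreeLE m p) (i : ℕ) :
    TotalDegreeLE (i * m) (p ^ i) := by
  induction i with
  | zero =>
    intro k l h
    simp only [pow_zero, Polynomial.coeff_one]
    split_ifs with hk
    · rw [Polynomial.coeff_one, if_neg (by omega)]
    · simp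
  | succ i ih =>
    rw [pow_succ, Nat.succ_mul]
    exact ih.mul hp

lemma TotalDegreeLE.sum {ι : Type*} {s : Finset ι} {n : ℕ} {p : ι → K[X][X]}
    (hp : ∀ i ∈ s, TotalDegreeLE n (p i)) : TotalDegreeLE n (∑ i ∈ s, p i) := by
  intro k l h
  rw [Polynomial.finsetSum_coeff, Polynomial.finsetSum_coeff]
  exact Finset.sum_eq_zero fun i hi ↦ hp i hi k l h

lemma totalDegreeLE_C_C (r : K) : TotalDegreeLE 0 (Polynomial.C (Polynomial.C r)) := by
  intro k l h
  rw [Polynomial.coeff_C]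
  split_ifs
  · rw [Polynomial.coeff_C, if_neg (by omega)]
  · simp

lemma totalDegreeLE_X : TotalDegreeLE 1 (Polynomial.X : K[X][X]) := by
  intro k l h
  rw [Polynomial.coeff_X]
  split_ifs
  · rw [Polynomial.coeff_one, if_neg (by omega)]
  · simp

lemma TotalDegreeLE.natDegree_coeff_le {n : ℕ} {p : K[X][X]} (hp : TotalDegreeLE n p) (k : ℕ) :
    (p.coeff k).natDegree ≤ n - k :=
  Polynomial.natDegree_le_iff_coeff_eq_zero.mpr fun l hl ↦ hp k l (by omega)

lemma TotalDegreeLE.natDegree_le {n : ℕ} {p : K[X][X]} (hp : TotalDegreeLE n p) :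
    p.natDegree ≤ n :=
  Polynomial.natDegree_le_iff_coeff_eq_zero.mpr fun k hk ↦
    Polynomial.ext fun l ↦ by simpa using hp k l (by omega)

lemma natDegree_resultant_le {m n : ℕ} {p q : K[X][X]} (hp : TotalDegreeLE m p)
    (hq : TotalDegreeLE n q) : (resultant p q m n).natDegree ≤ m * n := by
  rw [resultant, Matrix.det_apply]
  refine Polynomial.natDegree_sum_le_of_forall_le _ _ fun σ _ ↦ ?_
  refine (Polynomial.natDegree_smul_le _ _).trans ?_
  set S := Polynomial.sylvester p q m n with hS
  by_cases h0 : ∃ j, S (σ j) j = 0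
  · obtain ⟨j, hj⟩ := h0
    rw [Finset.prod_eq_zero (f := fun i ↦ S (σ i) i) (Finset.mem_univ j) hj]
    simp
  push Not at h0
  refine (Polynomial.natDegree_prod_le _ _).trans ?_
  have hleft (j : Fin m) : (S (σ (Fin.castAdd n j)) (Fin.castAdd n j)).natDegree
      + (σ (Fin.castAdd n j) : ℕ) ≤ n + j := by
    have h := h0 (Fin.castAdd n j)
    simp only [hS, Polynomial.sylvester, Matrix.of_apply, Fin.addCases_left] at h ⊢
    split_ifs at h ⊢ with hi
    · have := hq.natDegree_coeff_le ((σ (Fin.castAdd n j) : ℕ) - j)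
      simp only [Set.mem_Icc] at hi
      omega
    · exact absurd rfl h
  have hright (j : Fin n) : (S (σ (Fin.natAdd m j)) (Fin.natAdd m j)).natDegree
      + (σ (Fin.natAdd m j) : ℕ) ≤ m + j := by
    have h := h0 (Fin.natAdd m j)
    simp only [hS, Polynomial.sylvester, Matrix.of_apply, Fin.addCases_right] at h ⊢
    split_ifs at h ⊢ with hi
    · have := hp.natDegree_coeff_le ((σ (Fin.natAdd m j) : ℕ) - j)
      simp only [Set.mem_Icc] at hi
      omega
    · exact absurd rfl h
  have hsum : ∑ j, ((S (σ j) j).natDegree + (σ j : ℕ)) ≤ m * n + ∑ j : Fin (m + n), (j : ℕ) := by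
    rw [Fin.sum_univ_add, Fin.sum_univ_add (fun j : Fin (m + n) ↦ (j : ℕ))]
    have h₁ := Finset.sum_le_sum fun j (_ : j ∈ Finset.univ) ↦ hleft j
    have h₂ := Finset.sum_le_sum fun j (_ : j ∈ Finset.univ) ↦ hright j
    have h₃ : ∑ j : Fin m, (n + (j : ℕ)) = m * n + ∑ j : Fin m, (j : ℕ) := by
      simp [Finset.sum_add_distrib]
    simp only [Fin.val_castAdd, Fin.val_natAdd]
    omega
  rw [Finset.sum_add_distrib, Equiv.sum_comp σ (fun j ↦ (j : ℕ))] at hsum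
  omega

/-- The value at `(t, w)` of a polynomial in two variables. -/
noncomputable def biEval (t w : K) (p : K[X][X]) : K := (p.map (evalRingHom t)).eval w

lemma eval_resultant_eq_zero_of_biEval {m n : ℕ} (hm : m ≠ 0) {p q : K[X][X]}
    (hp : TotalDegreeLE m p) (hq : TotalDegreeLE n q) {t w : K}
    (hpw : biEval t w p = 0) (hqw : biEval t w q = 0) : (resultant p q m n).eval t = 0 := by
  obtain ⟨a, b, -, -, hab⟩ := Polynomial.exists_mul_add_mul_eq_C_resultant p q
    hp.natDegree_le hq.natDegree_le (Or.inl hm)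
  have := congrArg (biEval t w) hab
  unfold biEval at hpw hqw this
  simpa [hpw, hqw] using this.symm

end TotalDegree

lemma exists_biEval_eq_zero_of_eval_resultant {m n : ℕ} {p q : ℂ[X][X]}
    (hp : TotalDegreeLE m p) (hq : TotalDegreeLE n q) (hlead : (p.coeff m).coeff 0 ≠ 0) {t : ℂ}
    (h : (resultant p q m n).eval t = 0) : ∃ w, biEval t w p = 0 ∧ biEval t w q = 0 := by
  have hcoeff : (p.map (evalRingHom t)).coeff m ≠ 0 := by
    have := Polynomial.eq_C_of_natDegree_le_zero ((hp.natDegree_coeff_le m).trans (by simp))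
    rw [Polynomial.coeff_map, this]
    simpa using hlead
  have hdeg : (p.map (evalRingHom t)).natDegree = m :=
    le_antisymm (Polynomial.natDegree_map_le.trans hp.natDegree_le)
      (Polynomial.le_natDegree_of_ne_zero hcoeff)
  have hres := Polynomial.resultant_map_map p q m n (evalRingHom t)
  rw [Polynomial.coe_evalRingHom, h] at hres
  have hprod := Polynomial.resultant_eq_prod_eval (p.map (evalRingHom t)) (q.map (evalRingHom t)) n
    (Polynomial.natDegree_map_le.trans hq.natDegree_le) (IsAlgClosed.splits _)
  rw [hdeg, hres, eq_comm, mul_eq_zero, Multiset.prod_eq_zero_iff, Multiset.mem_map] at hprod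
  rcases hprod with h0 | ⟨w, hw, hqw⟩
  · rw [Polynomial.leadingCoeff, hdeg] at h0
    exact absurd (eq_zero_of_pow_eq_zero h0) hcoeff
  · exact ⟨w, (Polynomial.mem_roots'.mp hw).2, hqw⟩

lemma exists_separating_slope {P : Set (Fin 2 → ℂ)} (hP : P.Finite) {B : Set ℂ}
    (hB : B.Finite) : ∃ a ∉ B, Set.InjOn (fun z : Fin 2 → ℂ ↦ z 0 + a * z 1) P := by
  have hbad : (B ∪ (fun x : (Fin 2 → ℂ) × (Fin 2 → ℂ) ↦
      (x.1 0 - x.2 0) / (x.2 1 - x.1 1)) '' (P ×ˢ P)).Finite :=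
    hB.union ((hP.prod hP).image _)
  obtain ⟨a, ha⟩ := hbad.infinite_compl.nonempty
  simp only [Set.mem_compl_iff, Set.mem_union, not_or] at ha
  refine ⟨a, ha.1, fun x hx y hy hxy ↦ ?_⟩
  simp only at hxy
  have h1 : x 1 = y 1 := by
    by_contra hne
    refine ha.2 ⟨(x, y), ⟨hx, hy⟩, ?_⟩
    have : y 1 - x 1 ≠ 0 := sub_ne_zero.mpr (Ne.symm hne)
    simp only
    field_simp
    linear_combination hxy
  have h0 : x 0 = y 0 := by
    rw [h1] at hxy
    exact add_right_cancel hxy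
  funext i
  fin_cases i <;> assumption

section Curve

variable {K L : Type*} [CommRing K] [CommRing L] {D : ℕ}

/-- The value at `(z, w)` of the plane curve with coefficients `c`. -/
def curveEval (c : CoeffIdx D → K) (z w : K) : K :=
  ∑ p : CoeffIdx D, c p * z ^ (p.1.1 : ℕ) * w ^ (p.1.2 : ℕ)

/-- The form `t - a w` that recovers the first coordinate from `t = z + a w`. -/
noncomputable def slopeForm (a : K) : K[X][X] :=
  Polynomial.C Polynomial.X - Polynomial.C (Polynomial.C a) * Polynomial.X

/-- The plane curve with coefficients `c`, in the coordinates `t = z + a w` and `w`. -/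
noncomputable def slopeCurve (c : CoeffIdx D → K) (a : K) : K[X][X] :=
  ∑ p : CoeffIdx D, Polynomial.C (Polynomial.C (c p)) * slopeForm a ^ (p.1.1 : ℕ) *
    Polynomial.X ^ (p.1.2 : ℕ)

lemma totalDegreeLE_slopeForm (a : K) : TotalDegreeLE 1 (slopeForm a) := by
  intro k l h
  have h₁ : ((Polynomial.C (Polynomial.C a) * Polynomial.X : K[X][X]).coeff k).coeff l = 0 :=
    ((totalDegreeLE_C_C a).mul totalDegreeLE_X) k l (by omega)
  rw [slopeForm, Polynomial.coeff_sub, Polynomial.coeff_sub, h₁, sub_zero, Polynomial.coeff_C]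
  split_ifs
  · rw [Polynomial.coeff_X, if_neg (by omega)]
  · simp

lemma totalDegreeLE_slopeCurve (c : CoeffIdx D → K) (a : K) :
    TotalDegreeLE D (slopeCurve c a) := by
  refine TotalDegreeLE.sum fun p _ ↦ ?_
  refine (((totalDegreeLE_C_C (c p)).mul ((totalDegreeLE_slopeForm a).pow _)).mul
    (totalDegreeLE_X.pow _)).mono ?_
  have := p.2
  omega

@[simp] lemma biEval_slopeForm (a t w : K) : biEval t w (slopeForm a) = t - a * w := by
  simp [biEval, slopeForm]

lemma biEval_slopeCurve (c : CoeffIdx D → K) (a t w : K) :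
    biEval t w (slopeCurve c a) = curveEval c (t - a * w) w := by
  simp [biEval, slopeCurve, slopeForm, curveEval, Polynomial.map_sum, Polynomial.eval_finsetSum]

lemma map_slopeForm (φ : K →+* L) (a : K) :
    (slopeForm a).map (mapRingHom φ) = slopeForm (φ a) := by
  simp [slopeForm]

lemma map_slopeCurve (φ : K →+* L) (c : CoeffIdx D → K) (a : K) :
    (slopeCurve c a).map (mapRingHom φ) = slopeCurve (φ ∘ c) (φ a) := by
  simp [slopeCurve, Polynomial.map_sum, map_slopeForm]

/-- Coefficients of the logarithmic derivative `z ∂f/∂z`. -/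
def logDerivFst (c : CoeffIdx D → K) : CoeffIdx D → K := fun p ↦ ((p.1.1 : ℕ) : K) * c p

/-- Coefficients of the likelihood equation `u₂ z ∂f/∂z - u₁ w ∂f/∂w`. -/
def likelihoodCoeff (c : CoeffIdx D → K) (u : Fin 2 → K) : CoeffIdx D → K :=
  fun p ↦ (u 1 * ((p.1.1 : ℕ) : K) - u 0 * ((p.1.2 : ℕ) : K)) * c p

/-- The eliminant in `t = z + a w` of the curve and its likelihood equation. -/
noncomputable def eliminant (c : CoeffIdx D → K) (u : Fin 2 → K) (a : K) : K[X] :=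
  resultant (slopeCurve c a) (slopeCurve (likelihoodCoeff c u) a) D D

/-- The polynomial `z w (z ∂f/∂z)`, in the coordinates `t = z + a w` and `w`. -/
noncomputable def boundaryForm (c : CoeffIdx D → K) (a : K) : K[X][X] :=
  slopeCurve (logDerivFst c) a * (slopeForm a * Polynomial.X)

/-- The eliminant in `t = z + a w` of the curve and `z w (z ∂f/∂z)`. -/
noncomputable def boundaryEliminant (c : CoeffIdx D → K) (a : K) : K[X] :=
  resultant (slopeCurve c a) (boundaryForm c a) D (D + 2)

/-- The resultant that is nonzero when the eliminant has `D ^ 2` simple roots, none of which is a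
root of the boundary eliminant. -/
noncomputable def eliminantDiscr (c : CoeffIdx D → K) (u : Fin 2 → K) (a : K) : K :=
  resultant (eliminant c u a) ((eliminant c u a).derivative * boundaryEliminant c a)
    (D ^ 2) (D ^ 2 + D * (D + 2))

/-- The genericity condition on `(c, u)`, for the projection along slope `a`. -/
noncomputable def genericity (c : CoeffIdx D → K) (u : Fin 2 → K) (a : K) : K :=
  ((slopeCurve c a).coeff D).coeff 0 * (eliminant c u a).coeff (D ^ 2) * eliminantDiscr c u a

lemma totalDegreeLE_boundaryForm (c : CoeffIdx D → K) (a : K) :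
    TotalDegreeLE (D + 2) (boundaryForm c a) :=
  (totalDegreeLE_slopeCurve _ _).mul ((totalDegreeLE_slopeForm a).mul totalDegreeLE_X)

lemma biEval_boundaryForm (c : CoeffIdx D → K) (a t w : K) :
    biEval t w (boundaryForm c a) =
      curveEval (logDerivFst c) (t - a * w) w * ((t - a * w) * w) := by
  rw [← biEval_slopeCurve, ← biEval_slopeForm]
  simp [biEval, boundaryForm]

lemma natDegree_eliminant_le (c : CoeffIdx D → K) (u : Fin 2 → K) (a : K) :
    (eliminant c u a).natDegree ≤ D ^ 2 :=
  (natDegree_resultant_le (totalDegreeLE_slopeCurve _ _) (totalDegreeLE_slopeCurve _ _)).trans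
    (sq D).ge

lemma natDegree_derivative_mul_boundaryEliminant_le (c : CoeffIdx D → K) (u : Fin 2 → K) (a : K) :
    ((eliminant c u a).derivative * boundaryEliminant c a).natDegree ≤ D ^ 2 + D * (D + 2) := by
  refine Polynomial.natDegree_mul_le.trans (add_le_add ?_ ?_)
  · exact ((Polynomial.natDegree_derivative_le _).trans (Nat.sub_le _ _)).trans
      (natDegree_eliminant_le c u a)
  · exact natDegree_resultant_le (totalDegreeLE_slopeCurve _ _) (totalDegreeLE_boundaryForm _ _)

lemma map_eliminant (φ : K →+* L) (c : CoeffIdx D → K) (u : Fin 2 → K) (a : K) :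
    (eliminant c u a).map φ = eliminant (φ ∘ c) (φ ∘ u) (φ a) := by
  have h : φ ∘ likelihoodCoeff c u = likelihoodCoeff (φ ∘ c) (φ ∘ u) := by
    funext p
    simp [likelihoodCoeff]
  rw [eliminant, eliminant, ← Polynomial.coe_mapRingHom, ← Polynomial.resultant_map_map,
    map_slopeCurve, map_slopeCurve, h]

lemma map_boundaryEliminant (φ : K →+* L) (c : CoeffIdx D → K) (a : K) :
    (boundaryEliminant c a).map φ = boundaryEliminant (φ ∘ c) (φ a) := by
  have h : φ ∘ logDerivFst c = logDerivFst (φ ∘ c) := by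
    funext p
    simp [logDerivFst]
  rw [boundaryEliminant, boundaryEliminant, ← Polynomial.coe_mapRingHom,
    ← Polynomial.resultant_map_map, boundaryForm, Polynomial.map_mul, Polynomial.map_mul,
    map_slopeCurve, map_slopeCurve, map_slopeForm, Polynomial.map_X, h, boundaryForm]

lemma map_genericity (φ : K →+* L) (c : CoeffIdx D → K) (u : Fin 2 → K) (a : K) :
    φ (genericity c u a) = genericity (φ ∘ c) (φ ∘ u) (φ a) := by
  rw [genericity, genericity, eliminantDiscr, eliminantDiscr, map_mul, map_mul,
    ← Polynomial.resultant_map_map, Polynomial.map_mul, ← Polynomial.derivative_map,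
    map_eliminant, map_boundaryEliminant, ← map_eliminant φ, ← map_slopeCurve φ]
  simp

lemma eval_eliminant_eq_zero (hD : D ≠ 0) (c : CoeffIdx D → K) (u : Fin 2 → K) (a z w : K)
    (hf : curveEval c z w = 0) (hh : curveEval (likelihoodCoeff c u) z w = 0) :
    (eliminant c u a).eval (z + a * w) = 0 := by
  apply eval_resultant_eq_zero_of_biEval hD (totalDegreeLE_slopeCurve _ _)
    (totalDegreeLE_slopeCurve _ _) (w := w) <;>
  simpa [biEval_slopeCurve]

lemma eval_boundaryEliminant_eq_zero (hD : D ≠ 0) (c : CoeffIdx D → K) (a z w : K)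
    (hf : curveEval c z w = 0) (hg : curveEval (logDerivFst c) z w * (z * w) = 0) :
    (boundaryEliminant c a).eval (z + a * w) = 0 := by
  apply eval_resultant_eq_zero_of_biEval hD (totalDegreeLE_slopeCurve _ _)
    (totalDegreeLE_boundaryForm _ _) (w := w)
  · simpa [biEval_slopeCurve]
  · simpa [biEval_boundaryForm] using hg

end Curve

section Complex

variable {D : ℕ}

lemma exists_of_eval_eliminant_eq_zero {c : CoeffIdx D → ℂ} {u : Fin 2 → ℂ} {a t : ℂ}
    (hlead : ((slopeCurve c a).coeff D).coeff 0 ≠ 0) (h : (eliminant c u a).eval t = 0) :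
    ∃ z w, z + a * w = t ∧ curveEval c z w = 0 ∧ curveEval (likelihoodCoeff c u) z w = 0 := by
  obtain ⟨w, hf, hh⟩ := exists_biEval_eq_zero_of_eval_resultant (totalDegreeLE_slopeCurve _ _)
    (totalDegreeLE_slopeCurve _ _) hlead h
  rw [biEval_slopeCurve] at hf hh
  exact ⟨t - a * w, w, by ring, hf, hh⟩

lemma exists_of_eval_boundaryEliminant_eq_zero {c : CoeffIdx D → ℂ} {a t : ℂ}
    (hlead : ((slopeCurve c a).coeff D).coeff 0 ≠ 0) (h : (boundaryEliminant c a).eval t = 0) :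
    ∃ z w, z + a * w = t ∧ curveEval c z w = 0 ∧
      curveEval (logDerivFst c) z w * (z * w) = 0 := by
  obtain ⟨w, hf, hh⟩ := exists_biEval_eq_zero_of_eval_resultant (totalDegreeLE_slopeCurve _ _)
    (totalDegreeLE_boundaryForm _ _) hlead h
  rw [biEval_slopeCurve] at hf
  rw [biEval_boundaryForm] at hh
  exact ⟨t - a * w, w, by ring, hf, hh⟩

lemma eliminantDiscr_ne_zero_iff {c : CoeffIdx D → ℂ} {u : Fin 2 → ℂ} {a : ℂ}
    (hcoeff : (eliminant c u a).coeff (D ^ 2) ≠ 0) :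
    eliminantDiscr c u a ≠ 0 ↔ ∀ t, (eliminant c u a).eval t = 0 →
      (eliminant c u a).derivative.eval t ≠ 0 ∧ (boundaryEliminant c a).eval t ≠ 0 := by
  have hdeg : (eliminant c u a).natDegree = D ^ 2 :=
    le_antisymm (natDegree_eliminant_le c u a) (Polynomial.le_natDegree_of_ne_zero hcoeff)
  have hne : eliminant c u a ≠ 0 := fun h ↦ hcoeff (by simp [h])
  have hprod := Polynomial.resultant_eq_prod_eval (eliminant c u a) _ _
    (natDegree_derivative_mul_boundaryEliminant_le c u a) (IsAlgClosed.splits _)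
  rw [hdeg] at hprod
  rw [eliminantDiscr, hprod, mul_ne_zero_iff]
  have hlc : (eliminant c u a).leadingCoeff ^ (D ^ 2 + D * (D + 2)) ≠ 0 :=
    pow_ne_zero _ (Polynomial.leadingCoeff_ne_zero.mpr hne)
  simp only [hlc, ne_eq, not_false_eq_true, true_and, Multiset.prod_eq_zero_iff, Multiset.mem_map,
    Polynomial.mem_roots hne, Polynomial.IsRoot.def, Polynomial.eval_mul, mul_eq_zero, not_exists,
    not_and, not_or]

/-- The common zeros of the curve and its likelihood equation. -/
def likelihoodZeros (c : CoeffIdx D → ℂ) (u : Fin 2 → ℂ) : Set (Fin 2 → ℂ) :=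
  {z | curveEval c (z 0) (z 1) = 0 ∧ curveEval (likelihoodCoeff c u) (z 0) (z 1) = 0}

lemma finite_likelihoodZeros (hD : D ≠ 0) {c : CoeffIdx D → ℂ} {u : Fin 2 → ℂ} {a : ℂ}
    (hlead : ((slopeCurve c a).coeff D).coeff 0 ≠ 0) (hne : eliminant c u a ≠ 0) :
    (likelihoodZeros c u).Finite := by
  have hmap (t : ℂ) : (slopeCurve c a).map (evalRingHom t) ≠ 0 := by
    intro h
    have h₁ := congrArg (fun p ↦ Polynomial.coeff p D) h
    have h₂ := Polynomial.eq_C_of_natDegree_le_zero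
      (((totalDegreeLE_slopeCurve c a).natDegree_coeff_le D).trans (by simp))
    rw [Polynomial.coeff_map, h₂] at h₁
    exact hlead (by simpa using h₁)
  have hfin : (⋃ t ∈ (eliminant c u a).rootSet ℂ, (fun w ↦ ![t - a * w, w]) ''
      ((slopeCurve c a).map (evalRingHom t)).rootSet ℂ).Finite :=
    (Polynomial.rootSet_finite _ _).biUnion fun t _ ↦ (Polynomial.rootSet_finite _ _).image _
  refine hfin.subset fun z hz ↦ ?_
  simp only [Set.mem_iUnion]
  refine ⟨z 0 + a * z 1, ?_, z 1, ?_, ?_⟩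
  · rw [Polynomial.mem_rootSet]
    exact ⟨hne, by simpa using eval_eliminant_eq_zero hD c u a _ _ hz.1 hz.2⟩
  · rw [Polynomial.mem_rootSet]
    refine ⟨hmap _, ?_⟩
    have := biEval_slopeCurve c a (z 0 + a * z 1) (z 1)
    rw [add_sub_cancel_right, hz.1] at this
    simpa [biEval] using this
  · funext i
    fin_cases i <;> simp

lemma ncard_likelihoodZeros_le (hD : D ≠ 0) {c : CoeffIdx D → ℂ} {u : Fin 2 → ℂ} {a : ℂ}
    (hcoeff : (eliminant c u a).coeff (D ^ 2) ≠ 0) (hfin : (likelihoodZeros c u).Finite) :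
    (likelihoodZeros c u).ncard ≤ D ^ 2 := by
  let r : ℂ[X] :=
    (eliminant (Polynomial.C ∘ c) (Polynomial.C ∘ u) (Polynomial.X : ℂ[X])).coeff (D ^ 2)
  have hr (b : ℂ) : r.eval b = (eliminant c u b).coeff (D ^ 2) := by
    have h := map_eliminant (evalRingHom b) (Polynomial.C ∘ c) (Polynomial.C ∘ u) Polynomial.X
    have hc : evalRingHom b ∘ Polynomial.C ∘ c = c := by funext; simp
    have hu : evalRingHom b ∘ Polynomial.C ∘ u = u := by funext; simp
    rw [hc, hu, Polynomial.coe_evalRingHom, Polynomial.eval_X] at h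
    rw [← h, Polynomial.coeff_map, Polynomial.coe_evalRingHom]
  have hr0 : r ≠ 0 := fun h ↦ hcoeff (by rw [← hr, h, Polynomial.eval_zero])
  obtain ⟨b, hb, hinj⟩ := exists_separating_slope hfin (Polynomial.rootSet_finite r ℂ)
  have hb0 : eliminant c u b ≠ 0 := by
    intro h
    refine hb (Polynomial.mem_rootSet.mpr ⟨hr0, ?_⟩)
    rw [Polynomial.coe_aeval_eq_eval, hr, h, Polynomial.coeff_zero]
  calc (likelihoodZeros c u).ncard
      ≤ ((eliminant c u b).roots.toFinset : Set ℂ).ncard := by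
        refine Set.ncard_le_ncard_of_injOn _ (fun z hz ↦ ?_) hinj (Finset.finite_toSet _)
        simpa [hb0] using eval_eliminant_eq_zero hD c u b _ _ hz.1 hz.2
    _ ≤ (eliminant c u b).natDegree := by
        rw [Set.ncard_coe_finset]
        exact (Multiset.toFinset_card_le _).trans (Polynomial.card_roots' _)
    _ ≤ D ^ 2 := natDegree_eliminant_le c u b

lemma le_ncard_likelihoodZeros {c : CoeffIdx D → ℂ} {u : Fin 2 → ℂ} {a : ℂ}
    (hlead : ((slopeCurve c a).coeff D).coeff 0 ≠ 0)
    (hcoeff : (eliminant c u a).coeff (D ^ 2) ≠ 0)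
    (hsimple : ∀ t, (eliminant c u a).eval t = 0 → (eliminant c u a).derivative.eval t ≠ 0)
    (hfin : (likelihoodZeros c u).Finite) : D ^ 2 ≤ (likelihoodZeros c u).ncard := by
  have hne : eliminant c u a ≠ 0 := fun h ↦ hcoeff (by simp [h])
  have hnodup : (eliminant c u a).roots.Nodup := by
    rw [Multiset.nodup_iff_count_le_one]
    intro t
    rw [Polynomial.count_roots]
    by_contra! h
    have h' := (Polynomial.one_lt_rootMultiplicity_iff_isRoot hne).mp h
    exact hsimple t h'.1 h'.2
  calc D ^ 2 ≤ (eliminant c u a).natDegree := Polynomial.le_natDegree_of_ne_zero hcoeff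
    _ = ((eliminant c u a).roots.toFinset : Set ℂ).ncard := by
        rw [Set.ncard_coe_finset, Multiset.toFinset_card_of_nodup hnodup]
        exact (IsAlgClosed.splits _).natDegree_eq_card_roots
    _ ≤ ((fun z : Fin 2 → ℂ ↦ z 0 + a * z 1) '' likelihoodZeros c u).ncard := by
        refine Set.ncard_le_ncard (fun t ht ↦ ?_) (hfin.image _)
        obtain ⟨z, w, ht, hf, hh⟩ := exists_of_eval_eliminant_eq_zero hlead (t := t)
          (by simpa [hne] using ht)
        exact ⟨![z, w], ⟨by simpa using hf, by simpa using hh⟩, by simpa using ht⟩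
    _ ≤ (likelihoodZeros c u).ncard := Set.ncard_image_le hfin

lemma eval_planeCurve (c : CoeffIdx D → ℂ) (z : Fin 2 → ℂ) :
    eval z (planeCurve D c) = curveEval c (z 0) (z 1) := by
  simp [planeCurve, curveEval]

lemma mul_natCast_mul_pow_sub_one (x : ℂ) (i : ℕ) : x * (i * x ^ (i - 1)) = i * x ^ i := by
  cases i with
  | zero => simp
  | succ i => rw [Nat.add_sub_cancel, pow_succ]; ring

lemma mul_eval_pderiv_zero (c : CoeffIdx D → ℂ) (z : Fin 2 → ℂ) :
    z 0 * eval z (pderiv 0 (planeCurve D c)) = curveEval (logDerivFst c) (z 0) (z 1) := by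
  simp only [planeCurve, curveEval, logDerivFst, map_sum, Finset.mul_sum]
  refine Finset.sum_congr rfl fun p _ ↦ ?_
  have := mul_natCast_mul_pow_sub_one (z 0) p.1.1
  simp
  linear_combination c p * z 1 ^ (p.1.2 : ℕ) * this

lemma mul_eval_pderiv_one (c : CoeffIdx D → ℂ) (u z : Fin 2 → ℂ) :
    u 0 * (z 1 * eval z (pderiv 1 (planeCurve D c))) =
      u 1 * curveEval (logDerivFst c) (z 0) (z 1) -
        curveEval (likelihoodCoeff c u) (z 0) (z 1) := by
  simp only [planeCurve, curveEval, logDerivFst, likelihoodCoeff, map_sum, Finset.mul_sum,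
    ← Finset.sum_sub_distrib]
  refine Finset.sum_congr rfl fun p _ ↦ ?_
  have := mul_natCast_mul_pow_sub_one (z 1) p.1.2
  simp
  linear_combination u 0 * c p * z 0 ^ (p.1.1 : ℕ) * this

lemma setOf_critical_eq_likelihoodZeros {c : CoeffIdx D → ℂ} {u : Fin 2 → ℂ}
    (h : ∀ z ∈ likelihoodZeros c u, curveEval (logDerivFst c) (z 0) (z 1) * (z 0 * z 1) ≠ 0) :
    {z : Fin 2 → ℂ | (∀ i, z i ≠ 0) ∧ eval z (planeCurve D c) = 0 ∧
      ∃ lam : ℂ, ∀ i, u i = lam * z i * eval z (pderiv i (planeCurve D c))} =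
      likelihoodZeros c u := by
  ext z
  have h₀ := mul_eval_pderiv_zero c z
  have h₁ := mul_eval_pderiv_one c u z
  constructor
  · rintro ⟨-, hf, lam, hlam⟩
    refine ⟨by rwa [← eval_planeCurve], ?_⟩
    have e₀ := hlam 0
    have e₁ := hlam 1
    linear_combination h₁ - u 1 * h₀ +
      (z 1 * eval z (pderiv 1 (planeCurve D c))) * (-e₀)
      + z 0 * eval z (pderiv 0 (planeCurve D c)) * e₁
  · intro hz
    have hg := h z hz
    simp only [mul_ne_zero_iff] at hg
    obtain ⟨hg, hz0, hz1⟩ := hg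
    rw [hz.2, sub_zero] at h₁
    refine ⟨Fin.forall_fin_two.mpr ⟨hz0, hz1⟩, (eval_planeCurve c z).trans hz.1,
      u 0 / curveEval (logDerivFst c) (z 0) (z 1), Fin.forall_fin_two.mpr ⟨?_, ?_⟩⟩
    · rw [mul_assoc, h₀, div_mul_cancel₀ _ hg]
    · rw [mul_assoc, div_mul_eq_mul_div, h₁, mul_div_cancel_right₀ _ hg]

lemma ncard_critical_eq_of_genericity (hD : D ≠ 0) {c : CoeffIdx D → ℂ} {u : Fin 2 → ℂ} {a : ℂ}
    (h : genericity c u a ≠ 0) :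
    {z : Fin 2 → ℂ | (∀ i, z i ≠ 0) ∧ eval z (planeCurve D c) = 0 ∧
      ∃ lam : ℂ, ∀ i, u i = lam * z i * eval z (pderiv i (planeCurve D c))}.ncard = D ^ 2 := by
  rw [genericity, mul_ne_zero_iff, mul_ne_zero_iff] at h
  obtain ⟨⟨hlead, hcoeff⟩, hdiscr⟩ := h
  rw [eliminantDiscr_ne_zero_iff hcoeff] at hdiscr
  have hfin := finite_likelihoodZeros hD hlead (u := u) fun h ↦ hcoeff (by simp [h])
  rw [setOf_critical_eq_likelihoodZeros]
  · exact le_antisymm (ncard_likelihoodZeros_le hD hcoeff hfin)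
      (le_ncard_likelihoodZeros hlead hcoeff (fun t ht ↦ (hdiscr t ht).1) hfin)
  · intro z hz hg
    exact (hdiscr _ (eval_eliminant_eq_zero hD c u a _ _ hz.1 hz.2)).2
      (eval_boundaryEliminant_eq_zero hD c a _ _ hz.1 hg)

end Complex

section Fermat

variable (D : ℕ)

/-- The coefficients of the Fermat curve `z ^ D + w ^ D = 2`. -/
noncomputable def fermatCoeff : CoeffIdx D → ℂ :=
  Pi.single ⟨(Fin.last D, 0), by simp⟩ 1 + Pi.single ⟨(0, Fin.last D), by simp⟩ 1 +
    Pi.single ⟨(0, 0), by simp⟩ (-2)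

lemma curveEval_fermatCoeff (z w : ℂ) :
    curveEval (fermatCoeff D) z w = z ^ D + w ^ D - 2 := by
  simp [curveEval, fermatCoeff, Pi.single_apply, add_mul, Finset.sum_add_distrib, ite_mul]
  ring

lemma curveEval_logDerivFst_fermatCoeff (z w : ℂ) :
    curveEval (logDerivFst (fermatCoeff D)) z w = D * z ^ D := by
  simp [curveEval, logDerivFst, fermatCoeff, Pi.single_apply, mul_add, add_mul,
    Finset.sum_add_distrib, ite_mul]

lemma curveEval_likelihoodCoeff_fermatCoeff (z w : ℂ) :
    curveEval (likelihoodCoeff (fermatCoeff D) 1) z w = D * (z ^ D - w ^ D) := by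
  simp [curveEval, likelihoodCoeff, fermatCoeff, Pi.single_apply, mul_add, add_mul,
    Finset.sum_add_distrib, ite_mul]
  ring

variable {D}

lemma leadingCoeff_slopeCurve_fermatCoeff (hD : D ≠ 0) (a : ℂ) :
    ((slopeCurve (fermatCoeff D) a).coeff D).coeff 0 = (-a) ^ D + 1 := by
  have h : (slopeCurve (fermatCoeff D) a).map (evalRingHom 0) =
      Polynomial.C ((-a) ^ D + 1) * Polynomial.X ^ D - Polynomial.C 2 := by
    refine Polynomial.funext fun w ↦ ?_
    have := biEval_slopeCurve (fermatCoeff D) a 0 w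
    rw [curveEval_fermatCoeff, biEval] at this
    rw [this]
    simp only [zero_sub, ← neg_mul, mul_pow, Polynomial.eval_sub, Polynomial.eval_mul,
      Polynomial.eval_C, Polynomial.eval_pow, Polynomial.eval_X]
    ring
  have h' := congrArg (fun p ↦ Polynomial.coeff p D) h
  simp only [Polynomial.coeff_map, Polynomial.coe_evalRingHom, Polynomial.coeff_sub,
    Polynomial.coeff_C_mul_X_pow, Polynomial.coeff_C, if_true, if_neg hD, sub_zero] at h'
  rw [Polynomial.coeff_zero_eq_eval_zero, h']

lemma mem_likelihoodZeros_fermatCoeff (hD : D ≠ 0) {z : Fin 2 → ℂ} :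
    z ∈ likelihoodZeros (fermatCoeff D) 1 ↔ ∀ i, z i ^ D = 1 := by
  have hD' : (D : ℂ) ≠ 0 := Nat.cast_ne_zero.mpr hD
  simp only [likelihoodZeros, Set.mem_ofPred_eq, curveEval_fermatCoeff,
    curveEval_likelihoodCoeff_fermatCoeff, mul_eq_zero, hD', false_or, Fin.forall_fin_two]
  constructor
  · rintro ⟨h₁, h₂⟩
    constructor
    · linear_combination (h₁ + h₂) / 2
    · linear_combination (h₁ - h₂) / 2
  · rintro ⟨h₁, h₂⟩
    rw [h₁, h₂]
    norm_num

lemma ncard_likelihoodZeros_fermatCoeff (hD : D ≠ 0) :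
    (likelihoodZeros (fermatCoeff D) 1).ncard = D ^ 2 := by
  have hset : likelihoodZeros (fermatCoeff D) 1 =
      (Fintype.piFinset fun _ : Fin 2 ↦ Polynomial.nthRootsFinset D (1 : ℂ) : Set (Fin 2 → ℂ)) := by
    ext z
    rw [mem_likelihoodZeros_fermatCoeff hD, Finset.mem_coe, Fintype.mem_piFinset]
    simp [Polynomial.mem_nthRootsFinset (Nat.pos_of_ne_zero hD)]
  rw [hset, Set.ncard_coe_finset, Fintype.card_piFinset]
  simp [(Complex.isPrimitiveRoot_exp D hD).card_nthRootsFinset]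

lemma exists_genericity_fermatCoeff_ne_zero (hD : D ≠ 0) :
    ∃ a, genericity (fermatCoeff D) 1 a ≠ 0 := by
  have hroots (r : ℂ) : {x : ℂ | x ^ D = r}.Finite := by
    refine (Polynomial.nthRoots D r).toFinset.finite_toSet.subset fun x hx ↦ ?_
    simpa [Polynomial.mem_nthRoots (Nat.pos_of_ne_zero hD)] using hx
  have hV : {x : ℂ | x ^ D = 0 ∨ x ^ D = 1 ∨ x ^ D = 2}.Finite :=
    (hroots 0).union ((hroots 1).union (hroots 2))
  have hP : {z : Fin 2 → ℂ | ∀ i, z i ^ D = 0 ∨ z i ^ D = 1 ∨ z i ^ D = 2}.Finite :=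
    Set.Finite.pi' fun _ ↦ hV
  obtain ⟨a, ha, hinj⟩ := exists_separating_slope hP
    ((hroots (-1)).preimage (neg_injective.injOn (s := Neg.neg ⁻¹' {x : ℂ | x ^ D = -1})))
  have hlead : ((slopeCurve (fermatCoeff D) a).coeff D).coeff 0 ≠ 0 := by
    rw [leadingCoeff_slopeCurve_fermatCoeff hD]
    exact fun h ↦ ha (eq_neg_of_add_eq_zero_left h)
  have hsub : ∀ z ∈ likelihoodZeros (fermatCoeff D) 1,
      z ∈ {z : Fin 2 → ℂ | ∀ i, z i ^ D = 0 ∨ z i ^ D = 1 ∨ z i ^ D = 2} := fun z hz i ↦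
    Or.inr (Or.inl ((mem_likelihoodZeros_fermatCoeff hD).mp hz i))
  have hroot (t : ℂ) : (eliminant (fermatCoeff D) 1 a).eval t = 0 ↔
      t ∈ (fun z : Fin 2 → ℂ ↦ z 0 + a * z 1) '' likelihoodZeros (fermatCoeff D) 1 := by
    constructor
    · intro ht
      obtain ⟨z, w, ht, hf, hh⟩ := exists_of_eval_eliminant_eq_zero hlead ht
      exact ⟨![z, w], ⟨by simpa using hf, by simpa using hh⟩, by simpa using ht⟩
    · rintro ⟨z, hz, rfl⟩
      exact eval_eliminant_eq_zero hD _ _ _ _ _ hz.1 hz.2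
  have hne : eliminant (fermatCoeff D) 1 a ≠ 0 := by
    intro h
    refine Set.infinite_univ (((hP.subset hsub).image
      (fun z : Fin 2 → ℂ ↦ z 0 + a * z 1)).subset fun t (_ : t ∈ Set.univ) ↦ ?_)
    rw [← hroot, h, Polynomial.eval_zero]
  have hcard : (eliminant (fermatCoeff D) 1 a).roots.toFinset.card = D ^ 2 := by
    have hset : ((eliminant (fermatCoeff D) 1 a).roots.toFinset : Set ℂ) =
        (fun z : Fin 2 → ℂ ↦ z 0 + a * z 1) '' likelihoodZeros (fermatCoeff D) 1 := by
      ext t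
      rw [← hroot]
      simp [hne]
    rw [← Set.ncard_coe_finset, hset, (hinj.mono hsub).ncard_image,
      ncard_likelihoodZeros_fermatCoeff hD]
  have hle := Multiset.toFinset_card_le (eliminant (fermatCoeff D) 1 a).roots
  have hroots_le := Polynomial.card_roots' (eliminant (fermatCoeff D) 1 a)
  have hdeg_le := natDegree_eliminant_le (fermatCoeff D) 1 a
  have hcoeff : (eliminant (fermatCoeff D) 1 a).coeff (D ^ 2) ≠ 0 := by
    rw [show D ^ 2 = (eliminant (fermatCoeff D) 1 a).natDegree by omega]
    exact Polynomial.leadingCoeff_ne_zero.mpr hne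
  have hnodup : (eliminant (fermatCoeff D) 1 a).roots.Nodup :=
    Multiset.toFinset_card_eq_card_iff_nodup.mp (by omega)
  refine ⟨a, mul_ne_zero (mul_ne_zero hlead hcoeff) ?_⟩
  rw [eliminantDiscr_ne_zero_iff hcoeff]
  refine fun t ht ↦ ⟨fun hderiv ↦ ?_, fun hboundary ↦ ?_⟩
  · have h₁ := (Polynomial.one_lt_rootMultiplicity_iff_isRoot hne).mpr ⟨ht, hderiv⟩
    have h₂ := Multiset.nodup_iff_count_le_one.mp hnodup t
    rw [Polynomial.count_roots] at h₂
    omega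
  · obtain ⟨z, w, hzw, hf, hg⟩ := exists_of_eval_boundaryEliminant_eq_zero hlead hboundary
    obtain ⟨y, hy, hyt⟩ := (hroot t).mp ht
    rw [curveEval_fermatCoeff] at hf
    have hzero : z = 0 ∨ w = 0 := by
      simpa [curveEval_logDerivFst_fermatCoeff, hD] using hg
    have hmem : ![z, w] ∈ {z : Fin 2 → ℂ | ∀ i, z i ^ D = 0 ∨ z i ^ D = 1 ∨ z i ^ D = 2} := by
      rcases hzero with rfl | rfl
      · have hw : w ^ D = 2 := by
          rw [zero_pow hD] at hf
          linear_combination hf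
        simp [Fin.forall_fin_two, hw, hD]
      · have hz : z ^ D = 2 := by
          rw [zero_pow hD] at hf
          linear_combination hf
        simp [Fin.forall_fin_two, hz, hD]
    have hyz : y = ![z, w] := hinj (hsub y hy) hmem (by simpa [hzw] using hyt)
    have hy1 := (mem_likelihoodZeros_fermatCoeff hD).mp hy
    rw [hyz] at hy1
    have h₀ : z ^ D = 1 := by simpa using hy1 0
    have h₁ : w ^ D = 1 := by simpa using hy1 1
    rcases hzero with rfl | rfl
    · simp [hD] at h₀
    · simp [hD] at h₁

end Fermat

end MLDegree

/-- **The ML degree of a general very affine plane curve of degree `D` is `D²`** (`r₀ = D²`).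
There is a nonzero polynomial `G` in the coefficients `c_{ij}` and `u₁, u₂` such that
whenever `G(c,u) ≠ 0` the curve `f_c` has exactly `D²` ML-critical points for `u`. -/
theorem ml_degree_general_plane_curve (D : ℕ) (hD : 1 ≤ D) :
    ∃ G : MvPolynomial (CoeffIdx D ⊕ Fin 2) ℂ, G ≠ 0 ∧
      ∀ (c : CoeffIdx D → ℂ) (u : Fin 2 → ℂ), eval (Sum.elim c u) G ≠ 0 →
        {z : Fin 2 → ℂ | (∀ i, z i ≠ 0) ∧ eval z (planeCurve D c) = 0 ∧
            ∃ lam : ℂ, ∀ i, u i = lam * z i * eval z (pderiv i (planeCurve D c))}.ncard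
          = D ^ 2 := by
  have hD' : D ≠ 0 := Nat.one_le_iff_ne_zero.mp hD
  obtain ⟨a, ha⟩ := MLDegree.exists_genericity_fermatCoeff_ne_zero hD'
  have heval (c : CoeffIdx D → ℂ) (u : Fin 2 → ℂ) :
      eval (Sum.elim c u) (MLDegree.genericity (fun p ↦ X (Sum.inl p)) (fun i ↦ X (Sum.inr i))
        (C a) : MvPolynomial (CoeffIdx D ⊕ Fin 2) ℂ) = MLDegree.genericity c u a := by
    rw [MLDegree.map_genericity, eval_C]
    congr 1 <;> funext <;> simp
  refine ⟨_, fun h ↦ ha ?_, fun c u h ↦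
    MLDegree.ncard_critical_eq_of_genericity hD' (heval c u ▸ h)⟩
  rw [← heval, h, map_zero]
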